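/- Let K be a difference subfield of U with σ(K) = K, and a a finite tuple with σ(a) ∈ K(a)^alg and μ(σ(a)/K(a)) = ld(a/K). Let d be a finite tuple with σ(d) ∈ K(d)^alg and K(d)^alg = K(a)^alg, and suppose there is ℓ1 ∈ ℕ such that the coordinates of d lie in K(σ^{-ℓ}(a),σ^ℓ(a)) for every ℓ ≥ ℓ1. Then dd(d/K) = ld(d/K). -/

import Mathlib

/- Setting: a large algebraically closed field `U` with an automorphism `σ`.
   Tuples are maps `Fin n → U`; for a tuple `t`, the relevant set of coordinates
   is `Set.range t`.  `fAdj E s` is the subfield `E(s)` generated by a subfield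
   `E` and a set `s`, and `deg E s` is the degree `μ(s/E) = [E(s):E]`. -/

set_option maxHeartbeats 1000000
set_option synthInstance.maxHeartbeats 1000000

open Filter Set

variable {U : Type*}

/-- The subfield `E(s)` generated by the subfield `E` and the set `s`. -/
noncomputable def fAdj [Field U] (E : Subfield U) (s : Set U) : Subfield U :=
  (IntermediateField.adjoin E s).toSubfield

/-- The degree `μ(s/E) = [E(s):E]` (as `Module.finrank`; it is `0` when infinite). -/
noncomputable def deg [Field U] (E : Subfield U) (s : Set U) : ℕ :=
  Module.finrank E (IntermediateField.adjoin E s)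

/-- `k ↦ μ(σ^{k+1}(s) / K(s, σ(s), …, σ^k(s)))`: the sequence whose eventual
value is the limit degree `ld(s/K)`. -/
noncomputable def ldSeq [Field U] (σ : U ≃+* U) (K : Subfield U) (s : Set U) (k : ℕ) : ℕ :=
  deg (fAdj K (⋃ i ∈ Set.Iic k, ⇑(σ ^ i) '' s)) (⇑(σ ^ (k + 1)) '' s)

/-- `k ↦ μ(σ^k(s) / K(s))`: the sequence whose `k`-th roots converge to the
distant degree `dd(s/K)`. -/
noncomputable def ddSeq [Field U] (σ : U ≃+* U) (K : Subfield U) (s : Set U) (k : ℕ) : ℕ :=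
  deg (fAdj K s) (⇑(σ ^ k) '' s)

/-- The inversive closure `K^inv = ⋃ₙ σ^{-n}(K)`. -/
noncomputable def Kinv [Field U] (σ : U ≃+* U) (K : Subfield U) : Subfield U :=
  ⨆ n : ℕ, K.map (σ⁻¹ ^ n : U ≃+* U).toRingHom

/-- The difference field `K(s)_σ = K(σ^i(s) : i ∈ ℕ)` generated by `s` over `K`. -/
noncomputable def diffAdj [Field U] (σ : U ≃+* U) (K : Subfield U) (s : Set U) : Subfield U :=
  fAdj K (⋃ i : ℕ, ⇑(σ ^ i) '' s)

section RelativeDegree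

variable [Field U]

theorem fAdj_eq_sup (E : Subfield U) (s : Set U) : fAdj E s = E ⊔ Subfield.closure s := by
  apply le_antisymm
  · change Subfield.closure _ ≤ _
    rw [Subfield.closure_le]
    rintro x (⟨y, rfl⟩ | hx)
    · exact (le_sup_left : E ≤ _) y.2
    · exact (le_sup_right : Subfield.closure s ≤ _) (Subfield.subset_closure hx)
  · refine sup_le (fun x hx => ?_) (Subfield.closure_le.2 (IntermediateField.subset_adjoin E s))
    exact (IntermediateField.adjoin E s).algebraMap_mem ⟨x, hx⟩

theorem le_fAdj (E : Subfield U) (s : Set U) : E ≤ fAdj E s :=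
  (fAdj_eq_sup E s).symm ▸ le_sup_left

theorem deg_eq_relfinrank (E : Subfield U) (s : Set U) :
    deg E s = E.relfinrank (E ⊔ Subfield.closure s) := by
  rw [← fAdj_eq_sup, Subfield.relfinrank_eq_finrank_of_le (le_fAdj E s)]
  rfl

theorem deg_ne_zero {E : Subfield U} {s : Set U} (hs : s.Finite)
    (halg : ∀ x ∈ s, IsAlgebraic E x) : deg E s ≠ 0 := by
  have := hs.to_subtype
  have := IntermediateField.finiteDimensional_adjoin (K := E) (S := s)
    fun x hx => (halg x hx).isIntegral
  exact (Module.finrank_pos (R := E) (M := IntermediateField.adjoin E s)).ne'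

/-- Degrees do not increase under base change. -/
theorem relfinrank_sup_le {X Z W : Subfield U} (hXZ : X ≤ Z) (hXW : X ≤ W)
    (h0 : X.relfinrank W ≠ 0) :
    Z.relfinrank (Z ⊔ W) ≠ 0 ∧ Z.relfinrank (Z ⊔ W) ≤ X.relfinrank W := by
  rw [Subfield.relfinrank_eq_finrank_of_le hXW] at h0 ⊢
  let : Algebra X Z := (Subfield.inclusion hXZ).toAlgebra
  have : IsScalarTower X Z U := IsScalarTower.of_algebraMap_eq' rfl
  have hfin : FiniteDimensional X (Subfield.extendScalars hXW) :=
    Module.finite_of_finrank_pos (Nat.pos_of_ne_zero h0)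
  have key := IntermediateField.adjoin_rank_le_of_isAlgebraic_right (F := X) Z
    (Subfield.extendScalars hXW)
  have heq : Z.relfinrank (Z ⊔ W) = Module.finrank Z
      (IntermediateField.adjoin Z (Subfield.extendScalars hXW : Set U)) := by
    have := deg_eq_relfinrank Z (W : Set U)
    rw [Subfield.closure_eq] at this
    exact this.symm
  have hlt := key.trans_lt (Module.rank_lt_aleph0 X (Subfield.extendScalars hXW))
  have hfin' : FiniteDimensional Z
      (IntermediateField.adjoin Z (Subfield.extendScalars hXW : Set U)) :=
    Module.rank_lt_aleph0_iff.1 hlt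
  rw [heq]
  exact ⟨Module.finrank_pos.ne',
    Cardinal.toNat_le_toNat key (Module.rank_lt_aleph0 X (Subfield.extendScalars hXW))⟩

theorem relfinrank_le_of_le {X Y Z : Subfield U} (hXY : X ≤ Y) (hYZ : Y ≤ Z)
    (h0 : X.relfinrank Z ≠ 0) : X.relfinrank Y ≤ X.relfinrank Z := by
  have := Subfield.relfinrank_mul_relfinrank hXY hYZ
  exact Nat.le_of_dvd (Nat.pos_of_ne_zero h0) ⟨_, this.symm⟩

/-- If `Z` and `W` are linearly disjoint over `X` and `X ≤ Y ≤ Z`, then `YW ∩ Z = Y`. -/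
theorem sup_inf_le_left {X Y Z W : Subfield U} (hXY : X ≤ Y) (hYZ : Y ≤ Z) (hXW : X ≤ W)
    (h0 : X.relfinrank W ≠ 0) (hdisj : Z.relfinrank (Z ⊔ W) = X.relfinrank W) :
    (Y ⊔ W) ⊓ Z ≤ Y := by
  set T := (Y ⊔ W) ⊓ Z
  have hYT : Y ≤ T := le_inf le_sup_left hYZ
  have hTZ : T ≤ Z := inf_le_right
  obtain ⟨hY0, hY⟩ := relfinrank_sup_le hXY hXW h0
  obtain ⟨hT0, hT⟩ := relfinrank_sup_le hYT (le_sup_left : Y ≤ Y ⊔ W) hY0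
  rw [sup_eq_right.2 (inf_le_left : T ≤ Y ⊔ W)] at hT0 hT
  obtain ⟨hZ0, hZ⟩ := relfinrank_sup_le hTZ (inf_le_left : T ≤ Y ⊔ W) hT0
  rw [← sup_assoc, sup_eq_left.2 hYZ] at hZ
  have hmul := Subfield.relfinrank_mul_relfinrank hYT (inf_le_left : T ≤ Y ⊔ W)
  rw [← Subfield.relfinrank_eq_one_iff]
  have : Y.relfinrank (Y ⊔ W) = T.relfinrank (Y ⊔ W) := by omega
  rw [this] at hmul
  exact Nat.eq_of_mul_eq_mul_right (Nat.pos_of_ne_zero hT0) (by rw [hmul, one_mul])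

/-- If `Z` and `W` are linearly disjoint over `X` and `X ≤ Y ≤ W`, then `ZY ∩ W = Y`. -/
theorem sup_inf_le_right {X Y Z W : Subfield U} (hXY : X ≤ Y) (hYW : Y ≤ W) (hXZ : X ≤ Z)
    (h0 : X.relfinrank W ≠ 0) (hdisj : Z.relfinrank (Z ⊔ W) = X.relfinrank W) :
    (Z ⊔ Y) ⊓ W ≤ Y := by
  set T := (Z ⊔ Y) ⊓ W
  have hYT : Y ≤ T := le_inf le_sup_right hYW
  have hTW : T ≤ W := inf_le_right
  have hXYW := Subfield.relfinrank_mul_relfinrank hXY hYW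
  have hYTW := Subfield.relfinrank_mul_relfinrank hYT hTW
  have hZYW := Subfield.relfinrank_mul_relfinrank (le_sup_left : Z ≤ Z ⊔ Y)
    (sup_le_sup_left hYW Z)
  have hXY0 : X.relfinrank Y ≠ 0 := left_ne_zero_of_mul (hXYW ▸ h0)
  have hYW0 : Y.relfinrank W ≠ 0 := right_ne_zero_of_mul (hXYW ▸ h0)
  have hTW0 : T.relfinrank W ≠ 0 := right_ne_zero_of_mul (hYTW ▸ hYW0)
  obtain ⟨h10, h1⟩ := relfinrank_sup_le hXZ hXY hXY0
  obtain ⟨h20, h2⟩ := relfinrank_sup_le (inf_le_left : T ≤ Z ⊔ Y) hTW hTW0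
  rw [sup_assoc, sup_eq_right.2 hYW] at h2 h20
  rw [← Subfield.relfinrank_eq_one_iff]
  have h3 : X.relfinrank Y * (Y.relfinrank T * T.relfinrank W) ≤
      X.relfinrank Y * T.relfinrank W := by
    rw [hYTW, hXYW, ← hdisj, ← hZYW]
    exact Nat.mul_le_mul h1 h2
  have h4 := Nat.le_of_mul_le_mul_left h3 (Nat.pos_of_ne_zero hXY0)
  have h5 : Y.relfinrank T ≤ 1 :=
    Nat.le_of_mul_le_mul_right (by simpa using h4) (Nat.pos_of_ne_zero hTW0)
  have h6 : Y.relfinrank T ≠ 0 := left_ne_zero_of_mul (hYTW ▸ hYW0)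
  omega

end RelativeDegree

section Window

variable [Field U]

/-- The subfield `K(σ^j(s) : j ∈ S)` for a set `S` of integers. -/
noncomputable def window (σ : U ≃+* U) (K : Subfield U) (s : Set U) (S : Set ℤ) : Subfield U :=
  K ⊔ Subfield.closure (⋃ j ∈ S, ⇑(σ ^ j) '' s)

variable {σ : U ≃+* U} {K : Subfield U} {s : Set U}

theorem window_mono {S T : Set ℤ} (h : S ⊆ T) : window σ K s S ≤ window σ K s T :=
  sup_le_sup_left (Subfield.closure_mono (biUnion_subset_biUnion_left h)) _

theorem window_union (S T : Set ℤ) :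
    window σ K s (S ∪ T) = window σ K s S ⊔ window σ K s T := by
  rw [window, biUnion_union, Subfield.closure_union, window, window, sup_sup_distrib_left]

theorem mem_window {S : Set ℤ} {j : ℤ} (hj : j ∈ S) {x : U} (hx : x ∈ s) :
    (σ ^ j) x ∈ window σ K s S :=
  (le_sup_right : _ ≤ window σ K s S)
    (Subfield.subset_closure (mem_biUnion hj (mem_image_of_mem _ hx)))

theorem window_sup_closure (S : Set ℤ) (j : ℤ) :
    window σ K s S ⊔ Subfield.closure (⇑(σ ^ j) '' s) = window σ K s (insert j S) := by
  rw [window, window, biUnion_insert, Subfield.closure_union, sup_assoc,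
    sup_comm (Subfield.closure _)]

theorem fAdj_eq_window : fAdj K s = window σ K s {0} := by
  rw [fAdj_eq_sup, window, biUnion_singleton, zpow_zero]
  congr 2
  exact (image_id s).symm

theorem zpow_mem_iff (hK : K.map σ.toRingHom = K) (j : ℤ) (x : U) : (σ ^ j) x ∈ K ↔ x ∈ K := by
  have h1 (y : U) : σ y ∈ K ↔ y ∈ K := by
    constructor
    · intro hy
      rw [← hK] at hy
      obtain ⟨z, hz, hzy⟩ := hy
      exact σ.injective hzy ▸ hz
    · intro hy
      rw [← hK]
      exact ⟨y, hy, rfl⟩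
  induction j generalizing x with
  | zero => rfl
  | succ i ih =>
    rw [zpow_add_one, RingAut.mul_apply]
    exact (ih _).trans (h1 x)
  | pred i ih =>
    rw [zpow_sub_one, RingAut.mul_apply]
    refine (ih _).trans ?_
    rw [← h1, ← RingAut.mul_apply, mul_inv_cancel, RingAut.one_apply]

theorem map_window (hK : K.map σ.toRingHom = K) (j : ℤ) (S : Set ℤ) :
    (window σ K s S).map (σ ^ j : U ≃+* U).toRingHom = window σ K s ((fun i => j + i) '' S) := by
  rw [window, Subfield.map_sup, RingHom.map_field_closure, window]
  congr 1
  · ext x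
    constructor
    · rintro ⟨y, hy, rfl⟩
      exact (zpow_mem_iff hK j y).2 hy
    · intro hx
      refine ⟨(σ ^ (-j)) x, (zpow_mem_iff hK (-j) x).2 hx, ?_⟩
      change (σ ^ j) ((σ ^ (-j)) x) = x
      rw [← RingAut.mul_apply, ← zpow_add, add_neg_cancel]
      rfl
  · rw [image_iUnion₂, biUnion_image]
    congr 1
    refine iUnion₂_congr fun i _ => ?_
    rw [image_image]
    refine image_congr fun x _ => ?_
    rw [zpow_add]
    rfl

theorem relfinrank_window_image (hK : K.map σ.toRingHom = K) (j : ℤ) (S T : Set ℤ) :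
    (window σ K s ((fun i => j + i) '' S)).relfinrank (window σ K s ((fun i => j + i) '' T)) =
      (window σ K s S).relfinrank (window σ K s T) := by
  rw [← map_window hK, ← map_window hK, Subfield.relfinrank_map_map]

theorem relfinrank_window_Icc_add (hK : K.map σ.toRingHom = K) (j p m q : ℤ) :
    (window σ K s (Icc (j + p) (j + m))).relfinrank (window σ K s (Icc (j + p) (j + q))) =
      (window σ K s (Icc p m)).relfinrank (window σ K s (Icc p q)) := by
  simpa only [image_const_add_Icc] using relfinrank_window_image hK j (Icc p m) (Icc p q)

theorem mem_window_image (hK : K.map σ.toRingHom = K) {S : Set ℤ} (j : ℤ) {x : U}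
    (hx : x ∈ window σ K s S) : (σ ^ j) x ∈ window σ K s ((fun i => j + i) '' S) := by
  rw [← map_window hK]
  exact ⟨x, hx, rfl⟩

theorem ldSeq_eq (k : ℕ) : ldSeq σ K s k =
    (window σ K s (Icc 0 (k : ℤ))).relfinrank (window σ K s (Icc 0 (k + 1 : ℤ))) := by
  have h1 : fAdj K (⋃ i ∈ Iic k, ⇑(σ ^ i) '' s) = window σ K s (Icc 0 (k : ℤ)) := by
    rw [fAdj_eq_sup, window]
    congr 2
    ext x
    simp only [mem_iUnion, mem_Iic, mem_Icc, exists_prop]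
    constructor
    · rintro ⟨i, hi, hx⟩
      exact ⟨i, by omega, by simpa using hx⟩
    · rintro ⟨i, hi, hx⟩
      lift i to ℕ using hi.1
      exact ⟨i, by omega, by simpa using hx⟩
  have h2 : insert ((k + 1 : ℕ) : ℤ) (Icc 0 (k : ℤ)) = Icc 0 (k + 1 : ℤ) := by
    ext; simp; omega
  rw [ldSeq, h1, deg_eq_relfinrank, ← zpow_natCast, window_sup_closure, h2]

theorem ddSeq_eq (k : ℕ) : ddSeq σ K s k =
    (window σ K s {0}).relfinrank (window σ K s {0, (k : ℤ)}) := by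
  rw [ddSeq, fAdj_eq_window (σ := σ), deg_eq_relfinrank, ← zpow_natCast, window_sup_closure,
    pair_comm]

theorem deg_image_eq_ldSeq : deg (fAdj K s) (⇑σ '' s) = ldSeq σ K s 0 := by
  have h : (Icc 0 1 : Set ℤ) = {0, 1} := by ext; simp; omega
  have := ddSeq_eq (σ := σ) (K := K) (s := s) 1
  rw [ddSeq, pow_one] at this
  rw [this, ldSeq_eq]
  simp [h]

/-- The one-step degree over a window does not increase when the window grows to the left. -/
theorem relfinrank_window_succ_le {p p' m : ℤ} (hp : p ≤ p') (hm : p' ≤ m)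
    (h0 : (window σ K s (Icc p' m)).relfinrank (window σ K s (Icc p' (m + 1))) ≠ 0) :
    (window σ K s (Icc p m)).relfinrank (window σ K s (Icc p (m + 1))) ≠ 0 ∧
      (window σ K s (Icc p m)).relfinrank (window σ K s (Icc p (m + 1))) ≤
        (window σ K s (Icc p' m)).relfinrank (window σ K s (Icc p' (m + 1))) := by
  have h : Icc p m ∪ Icc p' (m + 1) = Icc p (m + 1) := by ext; simp; omega
  have key := relfinrank_sup_le (window_mono (σ := σ) (K := K) (s := s) (Icc_subset_Icc_left hp))
    (window_mono (σ := σ) (K := K) (s := s) (Icc_subset_Icc_right (by omega : m ≤ m + 1))) h0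
  rwa [← window_union, h] at key

theorem relfinrank_window_succ (hK : K.map σ.toRingHom = K) (p : ℤ) (k : ℕ) :
    (window σ K s (Icc p (p + k))).relfinrank (window σ K s (Icc p (p + k + 1))) =
      ldSeq σ K s k := by
  simpa only [ldSeq_eq, add_zero, add_assoc] using relfinrank_window_Icc_add hK p 0 k (k + 1)

theorem ldSeq_ne_zero (hK : K.map σ.toRingHom = K) (h0 : ldSeq σ K s 0 ≠ 0) (k : ℕ) :
    ldSeq σ K s k ≠ 0 := by
  rw [ldSeq_eq]
  refine (relfinrank_window_succ_le (p' := k) (by omega) le_rfl ?_).1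
  simpa using (relfinrank_window_succ (s := s) hK k 0).trans_ne h0

theorem ldSeq_antitone (hK : K.map σ.toRingHom = K) (h0 : ldSeq σ K s 0 ≠ 0) :
    Antitone (ldSeq σ K s) := by
  refine antitone_nat_of_succ_le fun k => ?_
  have h := relfinrank_window_succ (s := s) hK 1 k
  rw [add_comm 1 (k : ℤ)] at h
  rw [ldSeq_eq, ← h]
  push_cast
  exact (relfinrank_window_succ_le (by omega) (by omega)
    (h.trans_ne (ldSeq_ne_zero hK h0 k))).2

theorem relfinrank_window_zero (m : ℕ) :
    (window σ K s {0}).relfinrank (window σ K s (Icc 0 (m : ℤ))) =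
      ∏ i ∈ Finset.range m, ldSeq σ K s i := by
  induction m with
  | zero => simp
  | succ m ih =>
    rw [Finset.prod_range_succ, ← ih, ldSeq_eq, Subfield.relfinrank_mul_relfinrank]
    · push_cast; rfl
    · exact window_mono (by simp)
    · exact window_mono (Icc_subset_Icc_right (by omega))

theorem relfinrank_window_eq_pow (hK : K.map σ.toRingHom = K) {L : ℕ}
    (hL : ∀ k, ldSeq σ K s k = L) {p m : ℤ} (hpm : p ≤ m) (n : ℕ) :
    (window σ K s (Icc p m)).relfinrank (window σ K s (Icc p (m + n))) = L ^ n := by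
  induction n with
  | zero => simp
  | succ n ih =>
    rw [pow_succ, ← ih, ← hL (m + n - p).toNat, ← relfinrank_window_succ hK p]
    have h : p + ((m + n - p).toNat : ℤ) = m + n := by omega
    rw [h, Subfield.relfinrank_mul_relfinrank]
    · push_cast; rw [add_assoc]
    · exact window_mono (Icc_subset_Icc_right (by omega))
    · exact window_mono (Icc_subset_Icc_right (by omega))

/-- When the sequence `ldSeq` is constant, past and future are linearly disjoint over the
present. -/
theorem relfinrank_window_past_future (hK : K.map σ.toRingHom = K) {L : ℕ}
    (hL : ∀ k, ldSeq σ K s k = L) {p m q : ℤ} (hpm : p ≤ m) (hmq : m ≤ q) :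
    (window σ K s (Icc p m)).relfinrank (window σ K s (Icc p m) ⊔ window σ K s (Icc m q)) =
      (window σ K s {m}).relfinrank (window σ K s (Icc m q)) := by
  obtain ⟨n, rfl⟩ := Int.le.dest hmq
  have h : Icc p m ∪ Icc m (m + n) = Icc p (m + n) := by ext; simp; omega
  rw [← window_union, h, relfinrank_window_eq_pow hK hL hpm, ← Icc_self,
    relfinrank_window_eq_pow hK hL le_rfl]

theorem mem_window_pair (hK : K.map σ.toRingHom = K) {L : ℕ} (hL0 : L ≠ 0)
    (hL : ∀ k, ldSeq σ K s k = L) {ℓ₁ : ℕ} {x : U}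
    (hx : ∀ ℓ : ℕ, ℓ₁ ≤ ℓ → x ∈ window σ K s {-(ℓ : ℤ), (ℓ : ℤ)}) {i k : ℕ}
    (hi : ℓ₁ ≤ i) (hik : i + ℓ₁ ≤ k) : (σ ^ (i : ℤ)) x ∈ window σ K s {0, (k : ℤ)} := by
  have hsym (ℓ : ℕ) (hℓ : ℓ₁ ≤ ℓ) :
      (σ ^ (i : ℤ)) x ∈ window σ K s {(i : ℤ) - ℓ, (i : ℤ) + ℓ} := by
    have := mem_window_image hK (i : ℤ) (hx ℓ hℓ)
    rwa [image_pair, ← sub_eq_add_neg] at this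
  have hne {m q : ℤ} (hmq : m ≤ q) :
      (window σ K s {m}).relfinrank (window σ K s (Icc m q)) ≠ 0 := by
    obtain ⟨n, rfl⟩ := Int.le.dest hmq
    rw [← Icc_self, relfinrank_window_eq_pow hK hL le_rfl]
    exact pow_ne_zero _ hL0
  obtain ⟨j, rfl⟩ := Nat.exists_eq_add_of_le (show i ≤ k by omega)
  have h1 := hsym i hi
  have h2 := hsym j (by omega)
  rw [sub_self] at h1
  push_cast
  rcases le_total i j with hij | hij
  · refine sup_inf_le_right (X := window σ K s {0}) (Z := window σ K s (Icc (i - j : ℤ) 0))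
      (W := window σ K s (Icc 0 (i + j : ℤ))) (window_mono (by simp)) (window_mono ?_)
      (window_mono ?_) (hne (by omega))
      (relfinrank_window_past_future hK hL (by omega) (by omega)) ⟨?_, ?_⟩
    · rintro y (rfl | rfl) <;> simp <;> omega
    · rintro y rfl; simp; omega
    · rw [← window_union]
      refine window_mono ?_ h2
      rintro y (rfl | rfl) <;> simp; omega
    · refine window_mono ?_ h1
      rintro y (rfl | rfl) <;> simp <;> omega
  · refine sup_inf_le_left (X := window σ K s {(i + j : ℤ)})
      (Z := window σ K s (Icc 0 (i + j : ℤ))) (W := window σ K s (Icc (i + j : ℤ) (i + i : ℤ)))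
      (window_mono (by simp)) (window_mono ?_)
      (window_mono ?_) (hne (by omega))
      (relfinrank_window_past_future hK hL (by omega) (by omega)) ⟨?_, ?_⟩
    · rintro y (rfl | rfl) <;> simp <;> omega
    · rintro y rfl; simp; omega
    · rw [← window_union]
      refine window_mono ?_ h1
      rintro y (rfl | rfl) <;> simp; omega
    · refine window_mono ?_ h2
      rintro y (rfl | rfl) <;> simp <;> omega

end Window

section Growth

variable [Field U] {σ : U ≃+* U} {K : Subfield U} {s t : Set U}

theorem ddSeq_bounds_prod (hK : K.map σ.toRingHom = K) (h0 : ldSeq σ K s 0 ≠ 0) (k : ℕ) :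
    ddSeq σ K s k ≠ 0 ∧ ddSeq σ K s k ≤ ∏ i ∈ Finset.range k, ldSeq σ K s i := by
  have hle : window σ K s {0, (k : ℤ)} ≤ window σ K s (Icc 0 (k : ℤ)) :=
    window_mono (by rintro y (rfl | rfl) <;> simp)
  have hle' : window σ K s {0} ≤ window σ K s {0, (k : ℤ)} := window_mono (by simp)
  have hprod := relfinrank_window_zero (σ := σ) (K := K) (s := s) k
  have hne : (window σ K s {0}).relfinrank (window σ K s (Icc 0 (k : ℤ))) ≠ 0 := by
    rw [hprod]
    exact Finset.prod_ne_zero_iff.2 fun i _ => ldSeq_ne_zero hK h0 i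
  rw [← hprod, ddSeq_eq]
  exact ⟨left_ne_zero_of_mul (Subfield.relfinrank_mul_relfinrank hle' hle ▸ hne),
    relfinrank_le_of_le hle' hle hne⟩

theorem relfinrank_window_sup_pair_le (hK : K.map σ.toRingHom = K)
    (hN : (window σ K s {0}).relfinrank (window σ K s {0} ⊔ window σ K t {0}) ≠ 0) (k : ℤ) :
    (window σ K s {0, k}).relfinrank (window σ K s {0, k} ⊔ window σ K t {0, k}) ≠ 0 ∧
      (window σ K s {0, k}).relfinrank (window σ K s {0, k} ⊔ window σ K t {0, k}) ≤
        (window σ K s {0}).relfinrank (window σ K s {0} ⊔ window σ K t {0}) ^ 2 := by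
  set N := (window σ K s {0}).relfinrank (window σ K s {0} ⊔ window σ K t {0})
  have hshift : (window σ K s {k}).relfinrank (window σ K s {k} ⊔ window σ K t {k}) = N := by
    have h := Subfield.relfinrank_map_map (window σ K s {0})
      (window σ K s {0} ⊔ window σ K t {0}) (σ ^ k : U ≃+* U).toRingHom
    simpa only [Subfield.map_sup, map_window hK, image_singleton, add_zero] using h
  have hs0 : window σ K s {0} ≤ window σ K s {0, k} := window_mono (by simp)
  have hsk : window σ K s {k} ≤ window σ K s {0, k} := window_mono (by simp)
  have ht : window σ K t {0, k} = window σ K t {0} ⊔ window σ K t {k} := by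
    rw [← window_union]; rfl
  obtain ⟨h10, h1⟩ := relfinrank_sup_le hs0
    (le_sup_left : _ ≤ window σ K s {0} ⊔ window σ K t {0}) hN
  rw [← sup_assoc, sup_eq_left.2 hs0] at h1 h10
  obtain ⟨h20, h2⟩ := relfinrank_sup_le
    (hsk.trans (le_sup_left : _ ≤ window σ K s {0, k} ⊔ window σ K t {0}))
    (le_sup_left : _ ≤ window σ K s {k} ⊔ window σ K t {k}) (hshift.trans_ne hN)
  rw [← sup_assoc, sup_eq_left.2 (hsk.trans le_sup_left), hshift] at h2
  rw [← sup_assoc, sup_eq_left.2 (hsk.trans le_sup_left)] at h20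
  rw [ht, ← sup_assoc, ← Subfield.relfinrank_mul_relfinrank
    (le_sup_left : _ ≤ window σ K s {0, k} ⊔ window σ K t {0}) le_sup_left, pow_two]
  exact ⟨mul_ne_zero h10 h20, Nat.mul_le_mul h1 h2⟩

/-- If all but boundedly many of the conjugates `σ^i(s)`, `0 ≤ i ≤ k`, lie in `K(t, σ^k(t))`, then
up to a constant the degree of `σ^k(s)` over `K(s)` is that of `s, …, σ^k(s)` over `K(s)`. -/
theorem exists_prod_le_mul_ddSeq (hK : K.map σ.toRingHom = K) (h0 : ldSeq σ K s 0 ≠ 0)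
    (hN : (window σ K s {0}).relfinrank (window σ K s {0} ⊔ window σ K t {0}) ≠ 0) {ℓ₁ : ℕ}
    (hmem : ∀ i k : ℕ, ℓ₁ ≤ i → i + ℓ₁ ≤ k → ∀ x ∈ s,
      (σ ^ (i : ℤ)) x ∈ window σ K t {0, (k : ℤ)}) :
    ∃ C : ℕ, ∀ m : ℕ, ∏ i ∈ Finset.range m, ldSeq σ K s i ≤ C * ddSeq σ K s (m + ℓ₁) := by
  set N := (window σ K s {0}).relfinrank (window σ K s {0} ⊔ window σ K t {0})
  refine ⟨N ^ 2 * ∏ i ∈ Finset.range ℓ₁, ldSeq σ K s i, fun m => ?_⟩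
  have hdd0 := (ddSeq_bounds_prod hK h0 (m + ℓ₁)).1
  have hM0 : (window σ K s {0}).relfinrank (window σ K s (Icc 0 (ℓ₁ : ℤ))) ≠ 0 := by
    rw [relfinrank_window_zero]
    exact Finset.prod_ne_zero_iff.2 fun i _ => ldSeq_ne_zero hK h0 i
  obtain ⟨hH0, hH⟩ := relfinrank_window_sup_pair_le hK hN ((m + ℓ₁ : ℕ) : ℤ)
  rw [ddSeq_eq] at hdd0 ⊢
  rw [← relfinrank_window_zero, ← relfinrank_window_zero]
  set B := window σ K s {0}
  set D := window σ K s {0, ((m + ℓ₁ : ℕ) : ℤ)}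
  set H := D ⊔ window σ K t {0, ((m + ℓ₁ : ℕ) : ℤ)}
  set M := window σ K s (Icc 0 (ℓ₁ : ℤ))
  have hBD : B ≤ D := window_mono (by simp)
  have hDH : D ≤ H := le_sup_left
  obtain ⟨hT0, hT⟩ := relfinrank_sup_le (hBD.trans hDH) (window_mono (by simp) : B ≤ M) hM0
  have hsub : window σ K s (Icc 0 (m : ℤ)) ≤ H ⊔ M := by
    refine sup_le (le_sup_left.trans (le_sup_right : M ≤ _)) (Subfield.closure_le.2 ?_)
    refine iUnion₂_subset ?_
    rintro i ⟨hi0, him⟩ _ ⟨x, hx, rfl⟩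
    lift i to ℕ using hi0
    rcases le_total i ℓ₁ with hi | hi
    · exact (le_sup_right : M ≤ H ⊔ M) (mem_window (by simp; omega) hx)
    · exact (le_sup_right.trans le_sup_left : window σ K t _ ≤ H ⊔ M)
        (hmem i (m + ℓ₁) hi (by omega) x hx)
  have hBH := Subfield.relfinrank_mul_relfinrank hBD hDH
  have hBT := Subfield.relfinrank_mul_relfinrank (hBD.trans hDH) (le_sup_left : H ≤ H ⊔ M)
  have hBT0 : B.relfinrank (H ⊔ M) ≠ 0 := by
    rw [← hBT, ← hBH]
    exact mul_ne_zero (mul_ne_zero hdd0 hH0) hT0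
  calc _ ≤ B.relfinrank (H ⊔ M) := relfinrank_le_of_le (window_mono (by simp)) hsub hBT0
    _ = B.relfinrank D * D.relfinrank H * H.relfinrank (H ⊔ M) := by rw [← hBT, ← hBH]
    _ ≤ B.relfinrank D * N ^ 2 * B.relfinrank M := by gcongr
    _ = _ := by ring

theorem tendsto_const_mul_pow_rpow {c : ℝ} (hc : 0 < c) {L : ℝ} (hL : 0 ≤ L) :
    Tendsto (fun k : ℕ => (c * L ^ k) ^ (1 / (k : ℝ))) atTop (nhds L) := by
  have h1 : Tendsto (fun k : ℕ => c ^ (1 / (k : ℝ)) * L) atTop (nhds (1 * L)) := by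
    refine Tendsto.mul_const _ ?_
    have := (Real.continuousAt_const_rpow hc.ne' (b := 0)).tendsto.comp
      tendsto_one_div_atTop_nhds_zero_nat
    rwa [Real.rpow_zero] at this
  rw [one_mul] at h1
  refine h1.congr' ?_
  filter_upwards [eventually_ne_atTop 0] with k hk
  rw [Real.mul_rpow hc.le (pow_nonneg hL k), one_div, Real.pow_rpow_inv_natCast hL hk]

theorem tendsto_root_of_le_prod {f g : ℕ → ℕ} {L C ℓ : ℕ} (hf0 : ∀ k, f k ≠ 0)
    (hf : ∀ᶠ k in atTop, f k = L)
    (hupper : ∀ k, g k ≤ ∏ i ∈ Finset.range k, f i)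
    (hlower : ∀ m, ∏ i ∈ Finset.range m, f i ≤ C * g (m + ℓ)) :
    Tendsto (fun k => (g k : ℝ) ^ (1 / (k : ℝ))) atTop (nhds (L : ℝ)) := by
  obtain ⟨m₀, hm₀⟩ := eventually_atTop.1 hf
  have hL : (0 : ℝ) < L := by
    have := hf0 m₀
    rw [hm₀ m₀ le_rfl] at this
    positivity
  have hC : (0 : ℝ) < C := by
    have h : C ≠ 0 := by
      rintro rfl
      simpa using hlower 0
    positivity
  set P : ℕ → ℝ := fun m => ∏ i ∈ Finset.range m, (f i : ℝ)
  have hP0 (m : ℕ) : 0 < P m := by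
    refine Finset.prod_pos fun i _ => ?_
    have := hf0 i
    positivity
  have hP (n : ℕ) : P (m₀ + n) = P m₀ / L ^ m₀ * L ^ (m₀ + n) := by
    have : P (m₀ + n) = P m₀ * L ^ n := by
      induction n with
      | zero => simp
      | succ n ih =>
        rw [← add_assoc, pow_succ, ← mul_assoc, ← ih, ← hm₀ (m₀ + n) (by omega)]
        exact Finset.prod_range_succ _ _
    rw [this, pow_add]
    field_simp
  set c := P m₀ / L ^ m₀
  have hc0 : 0 < c := div_pos (hP0 _) (by positivity)
  refine tendsto_of_tendsto_of_tendsto_of_le_of_le'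
    (tendsto_const_mul_pow_rpow (c := c / (C * L ^ ℓ)) (by positivity) hL.le)
    (tendsto_const_mul_pow_rpow hc0 hL.le) ?_ ?_
  · filter_upwards [eventually_ge_atTop (m₀ + ℓ)] with k hk
    obtain ⟨n, rfl⟩ := Nat.exists_eq_add_of_le hk
    refine Real.rpow_le_rpow (by positivity) ?_ (by positivity)
    have h : P (m₀ + n) ≤ C * g (m₀ + n + ℓ) := by
      simp only [P]
      exact_mod_cast hlower (m₀ + n)
    rw [hP] at h
    rw [← div_le_iff₀' hC] at h
    rw [add_right_comm m₀ ℓ n, pow_add _ _ ℓ]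
    refine le_of_eq_of_le ?_ h
    field_simp
  · filter_upwards [eventually_ge_atTop m₀] with k hk
    obtain ⟨n, rfl⟩ := Nat.exists_eq_add_of_le hk
    refine Real.rpow_le_rpow (by positivity) ?_ (by positivity)
    rw [← hP]
    simp only [P]
    exact_mod_cast hupper (m₀ + n)

end Growth

/-- if `μ(σ(a)/K(a)) = ld(a/K)`, `d` is equi-algebraic with `a`
over `K`, and for some `ℓ1` the coordinates of `d` lie in
`K(σ^{-ℓ}(a),σ^ℓ(a))` for all `ℓ ≥ ℓ1`, then `dd(d/K) = ld(d/K)`. -/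
theorem stmt15 [Field U] [IsAlgClosed U] (σ : U ≃+* U) (K : Subfield U)
    (hK : K.map σ.toRingHom = K) {n r : ℕ} (a : Fin n → U) (d : Fin r → U)
    (ha : ∀ i, IsAlgebraic (fAdj K (Set.range a)) (σ (a i)))
    (La : ℕ) (hLa : ∀ᶠ k in atTop, ldSeq σ K (Set.range a) k = La)
    (hmu : deg (fAdj K (Set.range a)) (⇑σ '' Set.range a) = La)
    (hd : ∀ i, IsAlgebraic (fAdj K (Set.range d)) (σ (d i)))
    (heq : ∀ x : U, IsAlgebraic (fAdj K (Set.range a)) x ↔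
      IsAlgebraic (fAdj K (Set.range d)) x)
    (hℓ1 : ∃ ℓ1 : ℕ, ∀ ℓ : ℕ, ℓ1 ≤ ℓ → ∀ i,
      d i ∈ fAdj K (⇑(σ⁻¹ ^ ℓ) '' Set.range a ∪ ⇑(σ ^ ℓ) '' Set.range a))
    (Ld : ℕ) (hLd : ∀ᶠ k in atTop, ldSeq σ K (Set.range d) k = Ld) :
    Tendsto (fun k => (ddSeq σ K (Set.range d) k : ℝ) ^ (1 / (k : ℝ)))
      atTop (nhds (Ld : ℝ)) := by
  obtain ⟨ℓ₁, hℓ⟩ := hℓ1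
  have hLa0 : La ≠ 0 := by
    rw [← hmu]
    refine deg_ne_zero ((finite_range a).image _) ?_
    rintro _ ⟨_, ⟨i, rfl⟩, rfl⟩
    exact ha i
  have hd0 : ldSeq σ K (range d) 0 ≠ 0 := by
    rw [← deg_image_eq_ldSeq]
    refine deg_ne_zero ((finite_range d).image _) ?_
    rintro _ ⟨_, ⟨i, rfl⟩, rfl⟩
    exact hd i
  rw [deg_image_eq_ldSeq] at hmu
  have hconst (k : ℕ) : ldSeq σ K (range a) k = La := by
    have hanti := ldSeq_antitone hK (hmu.trans_ne hLa0)
    obtain ⟨m, hm⟩ := eventually_atTop.1 hLa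
    refine le_antisymm ((hanti (Nat.zero_le k)).trans_eq hmu) ?_
    rw [← hm (max k m) (le_max_right _ _)]
    exact hanti (le_max_left _ _)
  have hN : (window σ K (range d) {0}).relfinrank
      (window σ K (range d) {0} ⊔ window σ K (range a) {0}) ≠ 0 := by
    have hne : deg (fAdj K (range d)) (range a) ≠ 0 := by
      refine deg_ne_zero (finite_range a) ?_
      rintro _ ⟨i, rfl⟩
      rw [← heq]
      exact isAlgebraic_algebraMap (R := fAdj K (range a)) (A := U)
        ⟨a i, IntermediateField.subset_adjoin K _ ⟨i, rfl⟩⟩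
    rw [deg_eq_relfinrank, fAdj_eq_window (σ := σ)] at hne
    rwa [← fAdj_eq_window (s := range a), fAdj_eq_sup, ← sup_assoc,
      sup_eq_left.2 (show K ≤ window σ K (range d) {0} from le_sup_left)]
  have hmem (ℓ : ℕ) (h : ℓ₁ ≤ ℓ) (x : U) (hx : x ∈ range d) :
      x ∈ window σ K (range a) {-(ℓ : ℤ), (ℓ : ℤ)} := by
    obtain ⟨i, rfl⟩ := hx
    have := hℓ ℓ h i
    rwa [fAdj_eq_sup, inv_pow, ← zpow_natCast, ← zpow_neg,
      ← biUnion_pair _ _ fun j : ℤ => ⇑(σ ^ j) '' range a] at this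
  obtain ⟨C, hC⟩ := exists_prod_le_mul_ddSeq hK hd0 hN fun i k hi hik x hx =>
    mem_window_pair hK hLa0 hconst (fun ℓ h => hmem ℓ h x hx) hi hik
  exact tendsto_root_of_le_prod (ldSeq_ne_zero hK hd0) hLd
    (fun k => (ddSeq_bounds_prod hK hd0 k).2) hC
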